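/- arXiv:1512.04215 — 4 statements merged into one kernel-verified Lean document; each statement's English description precedes it below -/
import Mathlib

section
/- Splitting Lemma: Let U ⊆ ℍ be open and let f : U → ℍ be slice regular. Then for every I ∈ 𝕊 and every J ∈ 𝕊 perpendicular to I (i.e. with inner product ⟨I,J⟩ = 0 in the imaginary quaternions), there exist two holomorphic functions F, G : U ∩ ℂ_I → ℂ_I (holomorphic with respect to the complex structure of ℂ_I ≅ ℂ) such that f(z) = F(z) + G(z)J for every z = x + Iy ∈ U ∩ ℂ_I. -/
open Quaternion
open scoped InnerProductSpace

/-- The sphere `𝕊` of purely imaginary unit quaternions. -/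
def QSphere : Set ℍ := {q : ℍ | q ^ 2 = -1}

/-- The complex plane `ℂ_I` through `1` and `I`. -/
def slicePlane (I : ℍ) : Set ℍ := {q : ℍ | ∃ x y : ℝ, q = (x : ℍ) + y • I}

/-- A real differentiable `f` is (left) slice regular on `U` if on every slice `U ∩ ℂ_I`
it satisfies the Cauchy-Riemann equation `∂f/∂x + I ∂f/∂y = 0`. -/
def SliceRegularOn (f : ℍ → ℍ) (U : Set ℍ) : Prop :=
  DifferentiableOn ℝ f U ∧
    ∀ I ∈ QSphere, ∀ q ∈ U ∩ slicePlane I,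
      fderiv ℝ f q 1 + I * fderiv ℝ f q I = 0

/-- The embedding of `ℂ` onto the slice `ℂ_I`, sending `x + iy` to `x + Iy`. -/
noncomputable def sliceEmbed (I : ℍ) (z : ℂ) : ℍ := (z.re : ℍ) + z.im • I

/-- An imaginary unit has zero real part. -/
theorem re_eq_zero_of_mem_QSphere {I : ℍ} (hI : I ∈ QSphere) : I.re = 0 := by
  have h : I ^ 2 = -1 := hI
  have h0 := congrArg QuaternionAlgebra.re h
  have h1 := congrArg QuaternionAlgebra.imI h
  have h2 := congrArg QuaternionAlgebra.imJ h
  have h3 := congrArg QuaternionAlgebra.imK h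
  simp [pow_two] at h0 h1 h2 h3
  by_contra hre
  have e1 : I.imI = 0 := by
    apply mul_left_cancel₀ hre
    linarith
  have e2 : I.imJ = 0 := by
    apply mul_left_cancel₀ hre
    linarith
  have e3 : I.imK = 0 := by
    apply mul_left_cancel₀ hre
    linarith
  rw [e1, e2, e3] at h0
  nlinarith [sq_nonneg I.re]

/-- The imaginary coordinates of an imaginary unit form a unit vector. -/
theorem sum_sq_eq_one_of_mem_QSphere {I : ℍ} (hI : I ∈ QSphere) :
    I.imI * I.imI + I.imJ * I.imJ + I.imK * I.imK = 1 := by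
  have h : I ^ 2 = -1 := hI
  have h0 := congrArg QuaternionAlgebra.re h
  simp [pow_two, re_eq_zero_of_mem_QSphere hI] at h0
  linarith

/-- Perpendicular imaginary units anticommute. -/
theorem mul_eq_neg_mul_of_inner_eq_zero {I J : ℍ} (hI : I ∈ QSphere) (hJ : J ∈ QSphere)
    (hIJ : ⟪I, J⟫_ℝ = 0) : J * I = -(I * J) := by
  have hI0 := re_eq_zero_of_mem_QSphere hI
  have hJ0 := re_eq_zero_of_mem_QSphere hJ
  rw [Quaternion.inner_def] at hIJ
  simp [hI0, hJ0] at hIJ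
  ext <;> simp [hI0, hJ0] <;> linarith

/-- `sliceEmbed` as a continuous real linear map. -/
noncomputable def sliceEmbedCLM (I : ℍ) : ℂ →L[ℝ] ℍ :=
  Complex.reCLM.smulRight (1 : ℍ) + Complex.imCLM.smulRight I

theorem sliceEmbedCLM_apply (I : ℍ) (z : ℂ) : sliceEmbedCLM I z = sliceEmbed I z := by
  simp [sliceEmbedCLM, sliceEmbed, Algebra.smul_def]

/-- The orthogonal projection of `ℍ` onto the slice `ℂ_I`, read in `ℂ`. -/
noncomputable def sliceProj (I : ℍ) : ℍ →L[ℝ] ℂ :=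
  (innerSL ℝ (1 : ℍ)).smulRight (1 : ℂ) + (innerSL ℝ I).smulRight Complex.I

theorem sliceProj_re (I q : ℍ) : (sliceProj I q).re = q.re := by
  simp [sliceProj, Quaternion.inner_def]

theorem sliceProj_im (I q : ℍ) : (sliceProj I q).im = ⟪I, q⟫_ℝ := by
  simp [sliceProj]

/-- The projection onto `ℂ_I` turns left multiplication by `I` into multiplication by `i`. -/
theorem sliceProj_mul_left {I : ℍ} (hI : I ∈ QSphere) (q : ℍ) :
    sliceProj I (I * q) = Complex.I * sliceProj I q := by
  have hI0 := re_eq_zero_of_mem_QSphere hI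
  have hI1 := sum_sq_eq_one_of_mem_QSphere hI
  apply Complex.ext
  · simp [sliceProj_re, sliceProj_im, Quaternion.inner_def, hI0]
    ring
  · simp [sliceProj_re, sliceProj_im, Quaternion.inner_def, hI0]
    linear_combination q.re * hI1

theorem sliceEmbed_sliceProj {I : ℍ} (hI : I ∈ QSphere) (q : ℍ) :
    sliceEmbed I (sliceProj I q) = (2⁻¹ : ℝ) • (q - I * q * I) := by
  have hI0 := re_eq_zero_of_mem_QSphere hI
  have hI1 := sum_sq_eq_one_of_mem_QSphere hI
  ext <;> simp [sliceEmbed, sliceProj_re, sliceProj_im, Quaternion.inner_def, hI0]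
  · linear_combination (-q.re / 2) * hI1
  · linear_combination (q.imI / 2) * hI1
  · linear_combination (q.imJ / 2) * hI1
  · linear_combination (q.imK / 2) * hI1

/-- The splitting `ℍ = ℂ_I ⊕ ℂ_I J`. -/
theorem eq_sliceEmbed_add_sliceEmbed_mul {I J : ℍ} (hI : I ∈ QSphere) (hJ : J ∈ QSphere)
    (hIJ : ⟪I, J⟫_ℝ = 0) (q : ℍ) :
    q = sliceEmbed I (sliceProj I q) + sliceEmbed I (sliceProj I (q * -J)) * J := by
  have hJJ : J * J = -1 := by rw [← pow_two]; exact hJ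
  have hanti := mul_eq_neg_mul_of_inner_eq_zero hI hJ hIJ
  have h : (q * -J - I * (q * -J) * I) * J = q + I * q * I := by
    calc (q * -J - I * (q * -J) * I) * J
        = -(q * (J * J)) + I * q * (J * I) * J := by noncomm_ring
      _ = -(q * (J * J)) - I * q * I * (J * J) := by rw [hanti]; noncomm_ring
      _ = q + I * q * I := by rw [hJJ]; noncomm_ring
  rw [sliceEmbed_sliceProj hI, sliceEmbed_sliceProj hI, smul_mul_assoc, h, ← smul_add,
    sub_add_add_cancel, ← two_smul ℝ q, smul_smul]
  norm_num

/-- A real linear map intertwining left multiplication by `I` with multiplication by `i` sends a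
slice regular function on the slice `ℂ_I` to a holomorphic function. -/
theorem SliceRegularOn.differentiableOn_comp {f : ℍ → ℍ} {U : Set ℍ} (hf : SliceRegularOn f U)
    (hU : IsOpen U) {I : ℍ} (hI : I ∈ QSphere) (L : ℍ →L[ℝ] ℂ)
    (hL : ∀ q, L (I * q) = Complex.I * L q) :
    DifferentiableOn ℂ (fun z => L (f (sliceEmbed I z))) (sliceEmbed I ⁻¹' U) := by
  intro z hz
  apply DifferentiableAt.differentiableWithinAt
  have hdf : HasFDerivAt f (fderiv ℝ f (sliceEmbed I z)) (sliceEmbedCLM I z) := by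
    rw [sliceEmbedCLM_apply]
    exact (hf.1.differentiableAt (hU.mem_nhds hz)).hasFDerivAt
  have hd := L.hasFDerivAt.comp z (hdf.comp z (sliceEmbedCLM I).hasFDerivAt)
  have heq : (L ∘ f ∘ sliceEmbedCLM I) = fun z => L (f (sliceEmbed I z)) := by
    funext w
    simp [sliceEmbedCLM_apply]
  rw [heq] at hd
  rw [differentiableAt_complex_iff_differentiableAt_real]
  refine ⟨hd.differentiableAt, ?_⟩
  have hCR := hf.2 I hI (sliceEmbed I z) ⟨hz, z.re, z.im, rfl⟩
  rw [hd.fderiv]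
  have h1 : sliceEmbedCLM I 1 = 1 := by simp [sliceEmbedCLM]
  have hi : sliceEmbedCLM I Complex.I = I := by simp [sliceEmbedCLM]
  simp only [ContinuousLinearMap.comp_apply, h1, hi, smul_eq_mul]
  rw [eq_neg_of_add_eq_zero_left hCR, map_neg, hL, mul_neg, ← mul_assoc, Complex.I_mul_I]
  ring

/-- **Splitting Lemma.** If `f` is slice regular on an open set `U`, then for every
`I ∈ 𝕊` and every `J ∈ 𝕊` perpendicular to `I` there are two holomorphic functions
`F, G : U ∩ ℂ_I → ℂ_I` such that `f(z) = F(z) + G(z)J` on `U ∩ ℂ_I`. -/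
theorem splitting_lemma (U : Set ℍ) (hU : IsOpen U) (f : ℍ → ℍ)
    (hf : SliceRegularOn f U) (I : ℍ) (hI : I ∈ QSphere)
    (J : ℍ) (hJ : J ∈ QSphere) (hIJ : ⟪I, J⟫_ℝ = 0) :
    ∃ F G : ℂ → ℂ,
      DifferentiableOn ℂ F (sliceEmbed I ⁻¹' U) ∧
      DifferentiableOn ℂ G (sliceEmbed I ⁻¹' U) ∧
      ∀ z : ℂ, sliceEmbed I z ∈ U →
        f (sliceEmbed I z) = sliceEmbed I (F z) + sliceEmbed I (G z) * J := by
  refine ⟨fun z => sliceProj I (f (sliceEmbed I z)),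
    fun z => sliceProj I (f (sliceEmbed I z) * -J),
    hf.differentiableOn_comp hU hI (sliceProj I) (sliceProj_mul_left hI),
    hf.differentiableOn_comp hU hI
      ((sliceProj I).comp ((ContinuousLinearMap.mul ℝ ℍ).flip (-J))) fun q => ?_,
    fun z _ => eq_sliceEmbed_add_sliceEmbed_mul hI hJ hIJ _⟩
  simpa [mul_assoc] using sliceProj_mul_left hI (q * -J)
end

section
/- Let r > 0 and let f : B(0;r) → ℍ be slice regular on the open ball B(0;r) = {q ∈ ℍ : |q| < r}. Then there exists a sequence (aₙ) in ℍ with aₙ = (1/n!)·(∂ⁿf/∂xⁿ)(0) such that f(q) = Σ_{n=0}^∞ qⁿ aₙ for every q ∈ B(0;r), the series converging absolutely and uniformly on every compact subset of B(0;r); moreover f is infinitely (real) differentiable on B(0;r). -/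
open Quaternion
open scoped InnerProductSpace

/-- Taylor expansion of a holomorphic map, with coefficients read off along the real axis. -/
theorem hasSum_pow_smul_iteratedDeriv_ofReal {E : Type*} [NormedAddCommGroup E]
    [NormedSpace ℝ E] [NormedSpace ℂ E] [IsScalarTower ℝ ℂ E] [CompleteSpace E]
    {g : ℂ → E} {r : ℝ} (hg : DifferentiableOn ℂ g (Metric.ball 0 r))
    {z : ℂ} (hz : z ∈ Metric.ball (0 : ℂ) r) :
    HasSum (fun n : ℕ => z ^ n •
      ((n.factorial : ℝ))⁻¹ • iteratedDeriv n (fun x : ℝ => g (x : ℂ)) 0) (g z) := by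
  have hr : 0 < r := Metric.pos_of_mem_ball hz
  have hdiff : ∀ n : ℕ, DifferentiableOn ℂ (iteratedDeriv n g) (Metric.ball 0 r) := by
    intro n
    induction n with
    | zero => simpa using hg
    | succ n ih => rw [iteratedDeriv_succ]; exact ih.deriv Metric.isOpen_ball
  have key : ∀ n : ℕ, ∀ x : ℝ, (x : ℂ) ∈ Metric.ball (0 : ℂ) r →
      iteratedDeriv n (fun x : ℝ => g (x : ℂ)) x = iteratedDeriv n g (x : ℂ) := by
    intro n
    induction n with
    | zero => intro x _; simp
    | succ n ih =>
      intro x hx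
      have hd : DifferentiableAt ℂ (iteratedDeriv n g) (x : ℂ) :=
        (hdiff n).differentiableAt (Metric.isOpen_ball.mem_nhds hx)
      have hev : (iteratedDeriv n fun x : ℝ => g (x : ℂ)) =ᶠ[nhds x]
          iteratedDeriv n g ∘ Complex.ofReal := by
        filter_upwards [(Metric.isOpen_ball.preimage Complex.continuous_ofReal).mem_nhds hx]
          with y hy using ih y hy
      rw [iteratedDeriv_succ, iteratedDeriv_succ, hev.deriv_eq]
      simpa using (hd.hasDerivAt.scomp x Complex.ofRealCLM.hasDerivAt).deriv
  lift r to NNReal using hr.le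
  have h := Complex.hasSum_taylorSeries_on_ball hg hz
  convert h using 2 with n
  rw [key n 0 (by simpa using hr), sub_zero, Complex.ofReal_zero,
    ← algebraMap_smul ℂ ((n.factorial : ℝ))⁻¹, smul_comm]
  simp

theorem mul_self_of_mem_QSphere {I : ℍ} (hI : I ∈ QSphere) : I * I = -1 := by
  rw [← sq]; exact hI

theorem norm_eq_one_of_mem_QSphere {I : ℍ} (hI : I ∈ QSphere) : ‖I‖ = 1 := by
  have h : ‖I‖ ^ 2 = 1 := by rw [← norm_pow, show I ^ 2 = -1 from hI]; simp
  exact (pow_eq_one_iff_of_nonneg (norm_nonneg I) two_ne_zero).mp h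

theorem normSq_eq_one_of_mem_QSphere {I : ℍ} (hI : I ∈ QSphere) : normSq I = 1 := by
  rw [normSq_eq_norm_mul_self, norm_eq_one_of_mem_QSphere hI, mul_one]

/-- The embedding of `ℂ` onto the slice `ℂ_I`. -/
noncomputable def sliceEmbedding {I : ℍ} (hI : I ∈ QSphere) : ℂ →ₐ[ℝ] ℍ :=
  Complex.liftAux I (mul_self_of_mem_QSphere hI)

theorem sliceEmbedding_apply {I : ℍ} (hI : I ∈ QSphere) (z : ℂ) :
    sliceEmbedding hI z = (z.re : ℍ) + z.im • I :=
  rfl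

theorem sliceEmbedding_ofReal {I : ℍ} (hI : I ∈ QSphere) (x : ℝ) :
    sliceEmbedding hI (x : ℂ) = (x : ℍ) :=
  (sliceEmbedding hI).commutes x

theorem norm_sliceEmbedding {I : ℍ} (hI : I ∈ QSphere) (z : ℂ) :
    ‖sliceEmbedding hI z‖ = ‖z‖ := by
  have h0 := re_eq_zero_of_mem_QSphere hI
  have h1 := normSq_eq_one_of_mem_QSphere hI
  rw [normSq_def', h0] at h1
  rw [← sq_eq_sq₀ (norm_nonneg _) (norm_nonneg _), sq, ← normSq_eq_norm_mul_self,
    ← Complex.normSq_eq_norm_sq, normSq_def', sliceEmbedding_apply, Complex.normSq_apply]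
  simp [h0]
  linear_combination z.im ^ 2 * h1

theorem QSphere_nonempty : QSphere.Nonempty := by
  refine ⟨ofComplex Complex.I, ?_⟩
  change ofComplex Complex.I ^ 2 = -1
  rw [← map_pow, Complex.I_sq, map_neg, map_one]

theorem exists_mem_slicePlane (q : ℍ) : ∃ I ∈ QSphere, q ∈ slicePlane I := by
  by_cases h : q.im = 0
  · obtain ⟨I, hI⟩ := QSphere_nonempty
    refine ⟨I, hI, q.re, 0, ?_⟩
    rw [zero_smul, ← h, re_add_im]
  · have hn : ‖q.im‖ ≠ 0 := norm_ne_zero_iff.2 h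
    refine ⟨‖q.im‖⁻¹ • q.im, ?_, q.re, ‖q.im‖, ?_⟩
    · change _ ^ 2 = _
      rw [smul_pow, im_sq, normSq_eq_norm_mul_self, ← sq, smul_neg, smul_coe, ← mul_pow,
        inv_mul_cancel₀ hn]
      simp
    · rw [smul_inv_smul₀ hn, re_add_im]

theorem exists_sliceEmbedding_eq (q : ℍ) :
    ∃ (I : ℍ) (hI : I ∈ QSphere) (z : ℂ), sliceEmbedding hI z = q := by
  obtain ⟨I, hI, x, y, rfl⟩ := exists_mem_slicePlane q
  exact ⟨I, hI, ⟨x, y⟩, rfl⟩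

/-- The complex structure on `ℍ` in which `z` acts by left multiplication by its image in `ℂ_I`. -/
noncomputable abbrev sliceNormedSpace {I : ℍ} (hI : I ∈ QSphere) : NormedSpace ℂ ℍ where
  toModule := Module.compHom ℍ (sliceEmbedding hI).toRingHom
  norm_smul_le z q := by
    change ‖sliceEmbedding hI z * q‖ ≤ _
    rw [norm_mul, norm_sliceEmbedding]

theorem SliceRegularOn.hasSum {r : ℝ} {f : ℍ → ℍ}
    (hf : SliceRegularOn f (Metric.ball (0 : ℍ) r)) {q : ℍ} (hq : q ∈ Metric.ball (0 : ℍ) r) :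
    HasSum (fun n : ℕ => q ^ n *
      (((n.factorial : ℝ))⁻¹ • iteratedDeriv n (fun x : ℝ => f (x : ℍ)) 0)) (f q) := by
  obtain ⟨I, hI, z, rfl⟩ := exists_sliceEmbedding_eq q
  let _ : NormedSpace ℂ ℍ := sliceNormedSpace hI
  have hsmul : ∀ (w : ℂ) (p : ℍ), w • p = sliceEmbedding hI w * p := fun _ _ => rfl
  have : IsScalarTower ℝ ℂ ℍ := ⟨fun x w p => by rw [hsmul, hsmul, map_smul, smul_mul_assoc]⟩
  have hball : ∀ w : ℂ, w ∈ Metric.ball (0 : ℂ) r ↔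
      sliceEmbedding hI w ∈ Metric.ball (0 : ℍ) r := fun w => by
    rw [mem_ball_zero_iff, mem_ball_zero_iff, norm_sliceEmbedding]
  have hg : DifferentiableOn ℂ (fun w => f (sliceEmbedding hI w)) (Metric.ball 0 r) := by
    intro w hw
    have hw' := (hball w).1 hw
    have hfd := (hf.1.differentiableAt (Metric.isOpen_ball.mem_nhds hw')).hasFDerivAt
    have hcr := hf.2 I hI _ ⟨hw', w.re, w.im, rfl⟩
    set L := fderiv ℝ f (sliceEmbedding hI w)
    have hLI : L I = I * L 1 := by
      rw [eq_neg_of_add_eq_zero_left hcr, mul_neg, ← mul_assoc, mul_self_of_mem_QSphere hI]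
      simp
    have hcomp := hfd.comp w
      (sliceEmbedding hI).toLinearMap.toContinuousLinearMap.hasFDerivAt
    refine (hasFDerivAt_of_restrictScalars ℝ
      (f' := ContinuousLinearMap.toSpanSingleton ℂ (L 1)) hcomp
      ?_).differentiableAt.differentiableWithinAt
    refine ContinuousLinearMap.ext fun u => ?_
    change u • L 1 = L (sliceEmbedding hI u)
    have hre : ((u.re : ℝ) : ℍ) = u.re • (1 : ℍ) := by rw [← coe_mul_eq_smul, mul_one]
    rw [hsmul, sliceEmbedding_apply, hre, map_add, map_smul, map_smul, hLI, add_mul,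
      smul_mul_assoc, smul_mul_assoc, one_mul]
  have h := hasSum_pow_smul_iteratedDeriv_ofReal hg ((hball z).2 hq)
  simpa only [hsmul, map_pow, sliceEmbedding_ofReal] using h

/-- The formal multilinear series with value `q ^ n * a n` on the diagonal. -/
noncomputable def mulRightSeries (a : ℕ → ℍ) : FormalMultilinearSeries ℝ ℍ ℍ := fun n =>
  ((ContinuousLinearMap.mul ℝ ℍ).flip (a n)).compContinuousMultilinearMap
    (ContinuousMultilinearMap.mkPiAlgebraFin ℝ n ℍ)

theorem norm_mulRightSeries_le (a : ℕ → ℍ) (n : ℕ) : ‖mulRightSeries a n‖ ≤ ‖a n‖ := by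
  refine (ContinuousLinearMap.norm_compContinuousMultilinearMap_le _ _).trans ?_
  rw [ContinuousMultilinearMap.norm_mkPiAlgebraFin, mul_one]
  refine ContinuousLinearMap.opNorm_le_bound _ (norm_nonneg _) fun q => ?_
  simp [mul_comm]

theorem hasFPowerSeriesOnBall_mulRightSeries {r : ℝ} (hr : 0 < r) {f : ℍ → ℍ} {a : ℕ → ℍ}
    (h : ∀ q ∈ Metric.ball (0 : ℍ) r, HasSum (fun n : ℕ => q ^ n * a n) (f q)) :
    HasFPowerSeriesOnBall f (mulRightSeries a) 0 (ENNReal.ofReal r) where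
  r_le := by
    refine ENNReal.le_of_forall_nnreal_lt fun s hs => ?_
    refine FormalMultilinearSeries.le_radius_of_summable _ ?_
    have hs' : (s : ℝ) < r := by
      rwa [← ENNReal.ofReal_coe_nnreal, ENNReal.ofReal_lt_ofReal_iff hr] at hs
    have hsum := (h ((s : ℝ) : ℍ) (by simpa using hs')).summable.norm
    refine Summable.of_nonneg_of_le (fun n => by positivity) (fun n => ?_) hsum
    rw [norm_mul, norm_pow, norm_coe, mul_comm]
    simpa using mul_le_mul_of_nonneg_left (norm_mulRightSeries_le a n) (pow_nonneg s.2 n)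
  r_pos := by simpa using hr
  hasSum {q} hq := by
    rw [Metric.eball_ofReal] at hq
    simpa [mulRightSeries] using h q hq

/-- A slice regular function on the ball `B(0;r)` has a power series expansion
`f(q) = Σ qⁿ aₙ` with `aₙ = (1/n!) ∂ⁿf/∂xⁿ(0)`, converging absolutely and uniformly on
compact subsets of the ball; moreover `f` is infinitely (real) differentiable there. -/
theorem power_series_expansion (r : ℝ) (hr : 0 < r) (f : ℍ → ℍ)
    (hf : SliceRegularOn f (Metric.ball (0 : ℍ) r)) :
    ∃ a : ℕ → ℍ,
      (∀ n : ℕ, a n = ((n.factorial : ℝ))⁻¹ • iteratedDeriv n (fun x : ℝ => f (x : ℍ)) 0) ∧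
      (∀ q ∈ Metric.ball (0 : ℍ) r, HasSum (fun n : ℕ => q ^ n * a n) (f q)) ∧
      (∀ q ∈ Metric.ball (0 : ℍ) r, Summable (fun n : ℕ => ‖q ^ n * a n‖)) ∧
      (∀ K : Set ℍ, K ⊆ Metric.ball (0 : ℍ) r → IsCompact K →
        TendstoUniformlyOn (fun (N : ℕ) (q : ℍ) => ∑ n ∈ Finset.range N, q ^ n * a n) f
          Filter.atTop K) ∧
      ContDiffOn ℝ (⊤ : ℕ∞) f (Metric.ball (0 : ℍ) r) := by
  set a : ℕ → ℍ := fun n =>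
    ((n.factorial : ℝ))⁻¹ • iteratedDeriv n (fun x : ℝ => f (x : ℍ)) 0
  have hsum : ∀ q ∈ Metric.ball (0 : ℍ) r, HasSum (fun n : ℕ => q ^ n * a n) (f q) :=
    fun q hq => hf.hasSum hq
  refine ⟨a, fun _ => rfl, hsum, fun q hq => (hsum q hq).summable.norm, fun K hK hKc => ?_, ?_⟩
  · obtain ⟨s, ⟨hs0, hsr⟩, hKs⟩ := exists_pos_lt_subset_ball hr hKc.isClosed hK
    have hs : Summable fun n : ℕ => ‖(s : ℍ) ^ n * a n‖ :=
      (hsum s (by simpa [abs_of_pos hs0] using hsr)).summable.norm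
    refine (tendstoUniformlyOn_tsum_nat hs fun n q hq => ?_).congr_right
      fun q hq => (hsum q (hK hq)).tsum_eq
    have hqs : ‖q‖ ≤ s := (mem_ball_zero_iff.1 (hKs hq)).le
    rw [norm_mul, norm_mul, norm_pow, norm_pow, norm_coe, Real.norm_of_nonneg hs0.le]
    gcongr
  · have han := (hasFPowerSeriesOnBall_mulRightSeries hr hsum).analyticOnNhd
    rw [Metric.eball_ofReal] at han
    exact han.contDiffOn Metric.isOpen_ball.uniqueDiffOn
end

section
/- Representation Formula: Let U ⊆ ℍ be an axially symmetric slice domain and let f : U → ℍ be slice regular. Let J ∈ 𝕊 and x, y ∈ ℝ with x ± Jy ∈ U. Then for every I ∈ 𝕊, f(x + Iy) = (1/2)[f(x+Jy) + f(x−Jy)] + I·(1/2)[J(f(x−Jy) − f(x+Jy))]. Moreover the quantities α(x,y) := (1/2)[f(x+Ky) + f(x−Ky)] and β(x,y) := (1/2)[K(f(x−Ky) − f(x+Ky))] are independent of the choice of K ∈ 𝕊. -/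
open Quaternion
open scoped InnerProductSpace

/-- A slice domain: a connected open set intersecting the real axis whose
intersection with each complex plane `ℂ_I` is connected. -/
def SliceDomain (U : Set ℍ) : Prop :=
  IsOpen U ∧ IsConnected U ∧ (∃ x : ℝ, (x : ℍ) ∈ U) ∧
    ∀ I ∈ QSphere, IsPreconnected (U ∩ slicePlane I)

/-- `U` is axially symmetric if `x + Iy ∈ U` implies `x + Jy ∈ U` for all `J ∈ 𝕊`. -/
def AxiallySymmetric (U : Set ℍ) : Prop :=
  ∀ (x y : ℝ), ∀ I ∈ QSphere, ((x : ℍ) + y • I) ∈ U →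
    ∀ J ∈ QSphere, ((x : ℍ) + y • J) ∈ U

/-- A differentiable function on `ℂ` satisfying the Cauchy-Riemann equation is holomorphic. -/
lemma HasFDerivAt.differentiableAt_complex {E : Type*} [NormedAddCommGroup E] [NormedSpace ℝ E]
    [NormedSpace ℂ E] [IsScalarTower ℝ ℂ E] {g : ℂ → E} {D : ℂ →L[ℝ] E} {z : ℂ}
    (h : HasFDerivAt g D z) (hD : D Complex.I = Complex.I • D 1) : DifferentiableAt ℂ g z := by
  refine (hasFDerivAt_of_restrictScalars ℝ (f' := ContinuousLinearMap.toSpanSingleton ℂ (D 1)) h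
    ?_).differentiableAt
  refine ContinuousLinearMap.ext fun w => ?_
  have hw : w = w.re • (1 : ℂ) + w.im • Complex.I := by simp
  conv_rhs => rw [hw, map_add, map_smul, map_smul, hD]
  rw [← smul_assoc, ← smul_one_smul ℂ w.re (D 1), ← add_smul, ← hw]
  simp

namespace QSphere

lemma mul_self {I : ℍ} (hI : I ∈ QSphere) : I * I = -1 := by
  rw [← sq]; exact hI

lemma neg_mem {I : ℍ} (hI : I ∈ QSphere) : -I ∈ QSphere := by
  change (-I) ^ 2 = -1
  rw [neg_sq]; exact hI

lemma re_eq_zero {I : ℍ} (hI : I ∈ QSphere) : I.re = 0 := by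
  have h := mul_self hI
  have h0 := congrArg QuaternionAlgebra.re h
  have h1 := congrArg QuaternionAlgebra.imI h
  have h2 := congrArg QuaternionAlgebra.imJ h
  have h3 := congrArg QuaternionAlgebra.imK h
  simp at h0 h1 h2 h3
  by_contra hr
  have e1 : I.imI = 0 := by
    have : I.re * I.imI = 0 := by linarith
    simpa [hr] using this
  have e2 : I.imJ = 0 := by
    have : I.re * I.imJ = 0 := by linarith
    simpa [hr] using this
  have e3 : I.imK = 0 := by
    have : I.re * I.imK = 0 := by linarith
    simpa [hr] using this
  rw [e1, e2, e3] at h0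
  nlinarith [mul_self_nonneg I.re]

/-- The embedding `x + iy ↦ x + Iy` of `ℂ` onto the slice `ℂ_I`. -/
noncomputable def embed {I : ℍ} (hI : I ∈ QSphere) : ℂ →ₐ[ℝ] ℍ :=
  Complex.liftAux I (mul_self hI)

lemma embed_apply {I : ℍ} (hI : I ∈ QSphere) (z : ℂ) :
    embed hI z = (z.re : ℍ) + z.im • I := by
  rw [embed, Complex.liftAux_apply]; rfl

lemma norm_embed {I : ℍ} (hI : I ∈ QSphere) (z : ℂ) : ‖embed hI z‖ = ‖z‖ := by
  have h0 := congrArg QuaternionAlgebra.re (mul_self hI)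
  have hr := re_eq_zero hI
  simp [hr] at h0
  rw [← sq_eq_sq₀ (norm_nonneg _) (norm_nonneg _), Complex.sq_norm, Complex.normSq_apply, sq,
    ← Quaternion.normSq_eq_norm_mul_self, Quaternion.normSq_def', embed_apply]
  simp [hr]
  linear_combination -(z.im ^ 2) * h0

/-- `embed` as a linear isometry. -/
noncomputable def embedₗᵢ {I : ℍ} (hI : I ∈ QSphere) : ℂ →ₗᵢ[ℝ] ℍ :=
  ⟨(embed hI).toLinearMap, norm_embed hI⟩

lemma embedₗᵢ_apply {I : ℍ} (hI : I ∈ QSphere) (z : ℂ) :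
    embedₗᵢ hI z = (z.re : ℍ) + z.im • I := embed_apply hI z

/-- An identity principle: a function on a plane domain which is holomorphic for the complex
structure on `ℍ` given by left multiplication by `I`, and vanishes on the real axis, is zero. -/
lemma eqOn_zero_of_cauchyRiemann {I : ℍ} (hI : I ∈ QSphere) {Ω : Set ℂ} (hΩ : IsOpen Ω)
    (hc : IsPreconnected Ω) {g : ℂ → ℍ} {D : ℂ → ℂ →L[ℝ] ℍ}
    (hg : ∀ z ∈ Ω, HasFDerivAt g (D z) z)
    (hD : ∀ z ∈ Ω, D z Complex.I = I * D z 1)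
    {t : ℝ} (ht : (t : ℂ) ∈ Ω) (h0 : ∀ s : ℝ, g s = 0) : Set.EqOn g 0 Ω := by
  let : Module ℂ ℍ := Module.compHom ℍ (embed hI).toRingHom
  have smul_def : ∀ (z : ℂ) (q : ℍ), z • q = embed hI z * q := fun _ _ => rfl
  let : NormedSpace ℂ ℍ :=
    { norm_smul_le := fun z q => by rw [smul_def, norm_mul, norm_embed] }
  have : IsScalarTower ℝ ℂ ℍ := ⟨fun r z q => by
    rw [smul_def, smul_def, map_smul, smul_mul_assoc]⟩
  have hdiff : DifferentiableOn ℂ g Ω := fun z hz =>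
    ((hg z hz).differentiableAt_complex (by
      rw [hD z hz, smul_def, embed_apply]; simp)).differentiableWithinAt
  refine (hdiff.analyticOnNhd hΩ).eqOn_zero_of_preconnected_of_frequently_eq_zero hc ht ?_
  have htend : Filter.Tendsto (fun s : ℝ => (s : ℂ)) (nhdsWithin t {t}ᶜ)
      (nhdsWithin (t : ℂ) {(t : ℂ)}ᶜ) :=
    Complex.continuous_ofReal.continuousWithinAt.tendsto_nhdsWithin fun s hs => by
      simpa using hs
  exact htend.frequently (Filter.Frequently.of_forall h0)

end QSphere

open QSphere

/-- The planar domain `{x + iy | x + Jy ∈ U}` is preconnected. -/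
lemma SliceDomain.isPreconnected_preimage_embed {U : Set ℍ} (hdom : SliceDomain U) {J : ℍ}
    (hJ : J ∈ QSphere) : IsPreconnected (embedₗᵢ hJ ⁻¹' U) := by
  rw [← (embedₗᵢ hJ).isometry.isUniformInducing.isInducing.isPreconnected_image,
    Set.image_preimage_eq_inter_range]
  convert hdom.2.2.2 J hJ using 2
  ext q
  constructor
  · rintro ⟨z, rfl⟩
    exact ⟨z.re, z.im, embedₗᵢ_apply hJ z⟩
  · rintro ⟨x, y, rfl⟩
    exact ⟨⟨x, y⟩, embedₗᵢ_apply hJ _⟩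

/-- The restriction of a slice regular function to a slice satisfies the planar
Cauchy-Riemann equation. -/
lemma SliceRegularOn.exists_hasFDerivAt_comp_embed {f : ℍ → ℍ} {U : Set ℍ}
    (hf : SliceRegularOn f U) (hU : IsOpen U) {J : ℍ} (hJ : J ∈ QSphere) {z : ℂ}
    (hz : embedₗᵢ hJ z ∈ U) :
    ∃ D : ℂ →L[ℝ] ℍ, HasFDerivAt (fun w => f (embedₗᵢ hJ w)) D z ∧ D Complex.I = J * D 1 := by
  have hd := ((hf.1 _ hz).differentiableAt (hU.mem_nhds hz)).hasFDerivAt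
  refine ⟨_, hd.comp z (embedₗᵢ hJ).toContinuousLinearMap.hasFDerivAt, ?_⟩
  have h1 : embedₗᵢ hJ 1 = 1 := by simp [embedₗᵢ_apply]
  have hI : embedₗᵢ hJ Complex.I = J := by simp [embedₗᵢ_apply]
  have hcr := hf.2 J hJ _ ⟨hz, z.re, z.im, embedₗᵢ_apply hJ z⟩
  have := congrArg (J * ·) hcr
  simp only [mul_add, ← mul_assoc, mul_self hJ, mul_zero, neg_mul, one_mul] at this
  simp only [ContinuousLinearMap.comp_apply, LinearIsometry.coe_toContinuousLinearMap, h1, hI]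
  exact (add_neg_eq_zero.1 this).symm

/-- The values of a slice regular function on the slice `ℂ_I` are determined by those on `ℂ_J`. -/
lemma SliceRegularOn.eq_on_slice {U : Set ℍ} (hdom : SliceDomain U)
    (hsym : AxiallySymmetric U) {f : ℍ → ℍ} (hf : SliceRegularOn f U) {I J : ℍ}
    (hI : I ∈ QSphere) (hJ : J ∈ QSphere) {x y : ℝ} (hxy : ((x : ℍ) + y • J) ∈ U) :
    f ((x : ℍ) + y • I) =
        (2 : ℝ)⁻¹ • (f ((x : ℍ) + y • J) + f ((x : ℍ) - y • J)) +
          I * ((2 : ℝ)⁻¹ • (J * (f ((x : ℍ) - y • J) - f ((x : ℍ) + y • J)))) := by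
  have hmem : ∀ {K : ℍ} (hK : K ∈ QSphere), ∀ z ∈ embedₗᵢ hJ ⁻¹' U, embedₗᵢ hK z ∈ U := by
    intro K hK z hz
    rw [Set.mem_preimage, embedₗᵢ_apply] at hz
    rw [embedₗᵢ_apply]
    exact hsym _ _ J hJ hz K hK
  have hJ' := neg_mem hJ
  choose! A hA hA' using fun z (hz : z ∈ embedₗᵢ hJ ⁻¹' U) =>
    hf.exists_hasFDerivAt_comp_embed hdom.1 hI (hmem hI z hz)
  choose! B hB hB' using fun z (hz : z ∈ embedₗᵢ hJ ⁻¹' U) =>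
    hf.exists_hasFDerivAt_comp_embed hdom.1 hJ (hmem hJ z hz)
  choose! C hC hC' using fun z (hz : z ∈ embedₗᵢ hJ ⁻¹' U) =>
    hf.exists_hasFDerivAt_comp_embed hdom.1 hJ' (hmem hJ' z hz)
  obtain ⟨t, ht⟩ := hdom.2.2.1
  have key := eqOn_zero_of_cauchyRiemann hI (hdom.1.preimage (embedₗᵢ hJ).continuous)
    (hdom.isPreconnected_preimage_embed hJ)
    (fun z hz => (hA z hz).sub ((((hB z hz).add (hC z hz)).const_smul (2 : ℝ)⁻¹).add
      (((((hC z hz).sub (hB z hz)).const_mul J).const_smul (2 : ℝ)⁻¹).const_mul I)))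
    (fun z hz => ?_) (t := t) (by simpa [embedₗᵢ_apply] using ht) (fun s => ?_)
  · have := key (x := ⟨x, y⟩) (by simpa [embedₗᵢ_apply] using hxy)
    simpa [embedₗᵢ_apply, sub_eq_zero, ← sub_eq_add_neg] using this
  · have hII := mul_self hI
    have hJJ := mul_self hJ
    simp only [sub_apply, add_apply, smul_apply, hA' z hz, hB' z hz, hC' z hz, smul_eq_mul, neg_mul,
      mul_sub, mul_add, mul_neg, mul_smul_comm, smul_add, smul_sub, smul_neg]
    simp only [← mul_assoc, hII, hJJ, mul_neg, neg_mul, one_mul, smul_neg]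
    abel
  · simp [embedₗᵢ_apply, ← add_smul, sub_eq_zero]
    norm_num

/-- **Representation Formula.** For `f` slice regular on an axially symmetric slice
domain `U`, `J ∈ 𝕊` and `x ± Jy ∈ U`, one has for every `I ∈ 𝕊`
`f(x+Iy) = ½[f(x+Jy)+f(x−Jy)] + I·½[J(f(x−Jy)−f(x+Jy))]`; moreover the two bracketed
quantities do not depend on the imaginary unit used to compute them. -/
theorem representation_formula (U : Set ℍ) (hdom : SliceDomain U) (hsym : AxiallySymmetric U)
    (f : ℍ → ℍ) (hf : SliceRegularOn f U)
    (J : ℍ) (hJ : J ∈ QSphere) (x y : ℝ)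
    (hplus : ((x : ℍ) + y • J) ∈ U) (hminus : ((x : ℍ) - y • J) ∈ U) :
    (∀ I ∈ QSphere,
      f ((x : ℍ) + y • I) =
        (2 : ℝ)⁻¹ • (f ((x : ℍ) + y • J) + f ((x : ℍ) - y • J)) +
          I * ((2 : ℝ)⁻¹ • (J * (f ((x : ℍ) - y • J) - f ((x : ℍ) + y • J))))) ∧
    (∀ K ∈ QSphere, ∀ K' ∈ QSphere,
      (2 : ℝ)⁻¹ • (f ((x : ℍ) + y • K) + f ((x : ℍ) - y • K)) =
        (2 : ℝ)⁻¹ • (f ((x : ℍ) + y • K') + f ((x : ℍ) - y • K')) ∧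
      (2 : ℝ)⁻¹ • (K * (f ((x : ℍ) - y • K) - f ((x : ℍ) + y • K))) =
        (2 : ℝ)⁻¹ • (K' * (f ((x : ℍ) - y • K') - f ((x : ℍ) + y • K')))) := by
  have hU : ∀ {K : ℍ}, K ∈ QSphere → ((x : ℍ) + y • K) ∈ U := fun {K} hK =>
    hsym x y J hJ hplus K hK
  refine ⟨fun I hI => hf.eq_on_slice hdom hsym hI hJ hplus, fun K hK K' hK' => ?_⟩
  have h1 := hf.eq_on_slice hdom hsym hK hK' (hU hK')
  have h2 := hf.eq_on_slice hdom hsym (neg_mem hK) hK' (hU hK')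
  rw [smul_neg, ← sub_eq_add_neg] at h2
  set α := (2 : ℝ)⁻¹ • (f ((x : ℍ) + y • K') + f ((x : ℍ) - y • K'))
  set β := (2 : ℝ)⁻¹ • (K' * (f ((x : ℍ) - y • K') - f ((x : ℍ) + y • K')))
  rw [h1, h2]
  constructor
  · rw [show α + K * β + (α + -K * β) = (2 : ℝ) • α by rw [two_smul, neg_mul]; abel,
      smul_smul]
    norm_num
  · rw [show α + -K * β - (α + K * β) = (2 : ℝ) • -(K * β) by rw [two_smul, neg_mul]; abel,
      mul_smul_comm, smul_smul, mul_neg, ← mul_assoc, mul_self hK]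
    norm_num
end

section
/- Let q₀ = u + I₀v ∈ ℍ with u, v ∈ ℝ and I₀ ∈ 𝕊, and let a, b ∈ ℝ. As w = a + Jb ranges over the 2-sphere {a + Jb : J ∈ 𝕊}, the distance |w − q₀| attains its maximum and minimum at the points w = a + I₀b and w = a − I₀b; that is, for every J ∈ 𝕊, min(|a + I₀b − q₀|, |a − I₀b − q₀|) ≤ |a + Jb − q₀| ≤ max(|a + I₀b − q₀|, |a − I₀b − q₀|). -/
open Quaternion
open scoped InnerProductSpace

/-- A quaternion squaring to `-1` has zero real part and unit imaginary part. -/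
theorem QSphere.re_eq_zero_and_sum_sq {q : ℍ} (hq : q ∈ QSphere) :
    q.re = 0 ∧ q.imI ^ 2 + q.imJ ^ 2 + q.imK ^ 2 = 1 := by
  have h : q * q = -1 := by rw [← sq]; exact hq
  have hr := congrArg QuaternionAlgebra.re h
  have hi := congrArg QuaternionAlgebra.imI h
  have hj := congrArg QuaternionAlgebra.imJ h
  have hk := congrArg QuaternionAlgebra.imK h
  simp at hr hi hj hk
  have hre : q.re = 0 := by
    by_contra hne
    have hI : q.imI = 0 := mul_left_cancel₀ hne (by linarith)
    have hJ : q.imJ = 0 := mul_left_cancel₀ hne (by linarith)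
    have hK : q.imK = 0 := mul_left_cancel₀ hne (by linarith)
    rw [hI, hJ, hK] at hr
    nlinarith [sq_nonneg q.re]
  refine ⟨hre, ?_⟩
  rw [hre] at hr
  linarith

/-- The squared distance between `a + bJ` and `u + vI`, in terms of the inner product of the
imaginary units `I` and `J`. -/
theorem QSphere.norm_sub_sq (u v a b : ℝ) {I J : ℍ} (hI : I ∈ QSphere) (hJ : J ∈ QSphere) :
    ‖(a : ℍ) + b • J - ((u : ℍ) + v • I)‖ ^ 2 =
      (a - u) ^ 2 + b ^ 2 + v ^ 2
        - 2 * (b * v) * (I.imI * J.imI + I.imJ * J.imJ + I.imK * J.imK) := by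
  obtain ⟨hI0, hI1⟩ := QSphere.re_eq_zero_and_sum_sq hI
  obtain ⟨hJ0, hJ1⟩ := QSphere.re_eq_zero_and_sum_sq hJ
  rw [sq, ← Quaternion.normSq_eq_norm_mul_self, Quaternion.normSq_def']
  simp [hI0, hJ0]
  linear_combination b ^ 2 * hJ1 + v ^ 2 * hI1

/-- As `w = a + Jb` ranges over a 2-sphere `{a + Jb : J ∈ 𝕊}`, the distance
`|w − q₀|` to `q₀ = u + I₀v` attains its extrema at `a + I₀b` and `a − I₀b`. -/
theorem sphere_distance_extrema (u v a b : ℝ) (I₀ : ℍ) (hI₀ : I₀ ∈ QSphere)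
    (J : ℍ) (hJ : J ∈ QSphere) :
    min ‖(a : ℍ) + b • I₀ - ((u : ℍ) + v • I₀)‖ ‖(a : ℍ) - b • I₀ - ((u : ℍ) + v • I₀)‖ ≤
        ‖(a : ℍ) + b • J - ((u : ℍ) + v • I₀)‖ ∧
      ‖(a : ℍ) + b • J - ((u : ℍ) + v • I₀)‖ ≤
        max ‖(a : ℍ) + b • I₀ - ((u : ℍ) + v • I₀)‖
          ‖(a : ℍ) - b • I₀ - ((u : ℍ) + v • I₀)‖ := by
  have hneg : -I₀ ∈ QSphere := by
    change (-I₀) ^ 2 = -1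
    rw [neg_sq]
    exact hI₀
  obtain ⟨-, hI1⟩ := QSphere.re_eq_zero_and_sum_sq hI₀
  obtain ⟨-, hJ1⟩ := QSphere.re_eq_zero_and_sum_sq hJ
  have hdist := QSphere.norm_sub_sq u v a b hI₀ hJ
  have hplus := QSphere.norm_sub_sq u v a b hI₀ hI₀
  have hminus := QSphere.norm_sub_sq u v a b hI₀ hneg
  rw [smul_neg, ← sub_eq_add_neg] at hminus
  simp only [Quaternion.imI_neg, Quaternion.imJ_neg, Quaternion.imK_neg] at hminus
  set t := I₀.imI * J.imI + I₀.imJ * J.imJ + I₀.imK * J.imK with ht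
  have hle : t ≤ 1 := by
    nlinarith [sq_nonneg (I₀.imI - J.imI), sq_nonneg (I₀.imJ - J.imJ),
      sq_nonneg (I₀.imK - J.imK)]
  have hge : -1 ≤ t := by
    nlinarith [sq_nonneg (I₀.imI + J.imI), sq_nonneg (I₀.imJ + J.imJ),
      sq_nonneg (I₀.imK + J.imK)]
  have hplus' : ‖(a : ℍ) + b • I₀ - ((u : ℍ) + v • I₀)‖ ^ 2 =
      (a - u) ^ 2 + b ^ 2 + v ^ 2 - 2 * (b * v) := by
    linear_combination hplus - 2 * (b * v) * hI1
  have hminus' : ‖(a : ℍ) - b • I₀ - ((u : ℍ) + v • I₀)‖ ^ 2 =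
      (a - u) ^ 2 + b ^ 2 + v ^ 2 + 2 * (b * v) := by
    linear_combination hminus + 2 * (b * v) * hI1
  rw [min_le_iff, le_max_iff]
  simp only [← sq_le_sq₀ (norm_nonneg _) (norm_nonneg _), hdist, hplus', hminus']
  rcases le_total 0 (b * v) with hbv | hbv
  · exact ⟨Or.inl (by nlinarith), Or.inr (by nlinarith)⟩
  · exact ⟨Or.inr (by nlinarith), Or.inl (by nlinarith)⟩
end
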